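/- Let p, q : ℝ → ℝ³ be differentiable with ‖p(t)‖ = ‖q(t)‖ = 1 and p(t) ≠ ±q(t) for all t. For each t let R(t) be the rotation along the geodesic connecting p(t) to q(t), i.e. R(t)(x) := c·x + s·(k × x) + (1 − c)·(k·x)·k with c := p(t)·q(t), s := ‖p(t) × q(t)‖, k := (p(t) × q(t))/‖p(t) × q(t)‖. Let T : ℝ → ℝ³ be differentiable with ‖T(t)‖ = 1 and T(t)·p(t) = 0 for all t, set t̂(t) := p(t) × T(t) and q^⊥(t) := q(t) − (q(t)·p(t))·p(t). Let v : ℝ → ℝ with v(t) ≥ 0 and L > 0, and assume for all t: p′(t) = v(t)·(T(t) + L·(t̂(t)·q^⊥(t))·t̂(t)) and q′(t) = (p′(t)·T(t))·R(t)(T(t)). Then for every t, d/dt [arccos(p(t)·q(t))] = −L·v(t)·(t̂(t)·q^⊥(t))²/‖q^⊥(t)‖ ≤ 0; in particular the geodesic distance between p and q is nonincreasing. -/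

import Mathlib

open Real

/-- Euclidean dot product on ℝ³. -/
def dot3 (a b : Fin 3 → ℝ) : ℝ := a 0 * b 0 + a 1 * b 1 + a 2 * b 2

/-- Euclidean norm on ℝ³. -/
noncomputable def norm3 (a : Fin 3 → ℝ) : ℝ := Real.sqrt (dot3 a a)

/-- Cross product on ℝ³. -/
def cross3 (a b : Fin 3 → ℝ) : Fin 3 → ℝ :=
  ![a 1 * b 2 - a 2 * b 1, a 2 * b 0 - a 0 * b 2, a 0 * b 1 - a 1 * b 0]

/-- The rotation along the geodesic connecting the unit vectors `p` and `q` (the Rodrigues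
rotation about the axis `p × q` by the angle `arccos(p·q)`), applied to `x`:
`R(x) = c·x + s·(k × x) + (1 − c)·(k·x)·k` with `c = p·q`, `s = ‖p × q‖`,
`k = (p × q)/‖p × q‖`. -/
noncomputable def Rgeo (p q x : Fin 3 → ℝ) : Fin 3 → ℝ :=
  dot3 p q • x
    + norm3 (cross3 p q) • cross3 ((norm3 (cross3 p q))⁻¹ • cross3 p q) x
    + ((1 - dot3 p q) * dot3 ((norm3 (cross3 p q))⁻¹ • cross3 p q) x)
        • ((norm3 (cross3 p q))⁻¹ • cross3 p q)

theorem dot3_self_nonneg (a : Fin 3 → ℝ) : 0 ≤ dot3 a a := by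
  unfold dot3
  nlinarith [mul_self_nonneg (a 0), mul_self_nonneg (a 1), mul_self_nonneg (a 2)]

theorem dot3_self_pos {a : Fin 3 → ℝ} (h : a ≠ 0) : 0 < dot3 a a := by
  refine lt_of_le_of_ne (dot3_self_nonneg a) fun h0 => h ?_
  unfold dot3 at h0
  have h1 := mul_self_nonneg (a 0)
  have h2 := mul_self_nonneg (a 1)
  have h3 := mul_self_nonneg (a 2)
  have z0 : a 0 = 0 := mul_self_eq_zero.mp (by linarith)
  have z1 : a 1 = 0 := mul_self_eq_zero.mp (by linarith)
  have z2 : a 2 = 0 := mul_self_eq_zero.mp (by linarith)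
  ext i
  fin_cases i <;> assumption

theorem dot3_self_eq_one {a : Fin 3 → ℝ} (h : norm3 a = 1) : dot3 a a = 1 :=
  Real.sqrt_eq_one.mp h

theorem dot3_lt_one {p q : Fin 3 → ℝ} (hp : dot3 p p = 1) (hq : dot3 q q = 1) (h : p ≠ q) :
    dot3 p q < 1 := by
  have := dot3_self_pos (sub_ne_zero.mpr h)
  simp only [dot3, Pi.sub_apply] at *
  linarith

theorem neg_one_lt_dot3 {p q : Fin 3 → ℝ} (hp : dot3 p p = 1) (hq : dot3 q q = 1)
    (h : p ≠ -q) : -1 < dot3 p q := by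
  have := dot3_self_pos (sub_ne_zero.mpr h)
  simp only [dot3, Pi.sub_apply, Pi.neg_apply] at *
  linarith

theorem dot3_cross3_self {p q : Fin 3 → ℝ} :
    dot3 (cross3 p q) (cross3 p q) = dot3 p p * dot3 q q - dot3 p q ^ 2 := by
  simp [dot3, cross3]
  ring

theorem norm3_perp {p q : Fin 3 → ℝ} (hp : dot3 p p = 1) (hq : dot3 q q = 1) :
    norm3 (q - dot3 q p • p) = √(1 - dot3 p q ^ 2) := by
  unfold norm3
  congr 1
  have expand : dot3 (q - dot3 q p • p) (q - dot3 q p • p)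
      = dot3 q q - 2 * dot3 p q ^ 2 + dot3 p q ^ 2 * dot3 p p := by
    simp [dot3]
    ring
  rw [expand, hp, hq]
  ring

theorem dot3_cross3_perp (p q T : Fin 3 → ℝ) (c : ℝ) :
    dot3 (cross3 p T) (q - c • p) = dot3 (cross3 p T) q := by
  simp [dot3, cross3]
  ring

/-- The rotation taking `p` to `q` turns the component of a tangent vector at `p` along `q`
into minus its component along `p`. -/
theorem dot3_Rgeo {p q T : Fin 3 → ℝ} (hp : dot3 p p = 1) (hT : dot3 T p = 0)
    (hs : norm3 (cross3 p q) ≠ 0) : dot3 p (Rgeo p q T) = -dot3 T q := by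
  have expand : dot3 p (Rgeo p q T) = dot3 p q * dot3 T p
      + norm3 (cross3 p q) * (norm3 (cross3 p q))⁻¹
        * (dot3 T p * dot3 p q - dot3 T q * dot3 p p) := by
    unfold Rgeo
    generalize norm3 (cross3 p q) = s
    simp [dot3, cross3, Matrix.vecHead, Matrix.vecTail]
    ring
  rw [expand, hp, hT, mul_inv_cancel₀ hs]
  ring

theorem HasDerivAt.dot3 {p q : ℝ → Fin 3 → ℝ} {p' q' : Fin 3 → ℝ} {t : ℝ}
    (hp : HasDerivAt p p' t) (hq : HasDerivAt q q' t) :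
    HasDerivAt (fun s => dot3 (p s) (q s)) (dot3 p' (q t) + dot3 (p t) q') t := by
  have hp := hasDerivAt_pi.mp hp
  have hq := hasDerivAt_pi.mp hq
  refine ((((hp 0).mul (hq 0)).add ((hp 1).mul (hq 1))).add ((hp 2).mul (hq 2))).congr_deriv ?_
  simp only [_root_.dot3]
  ring

/-- Outer-loop tracking: if the kite position `p` on the unit sphere follows the commanded
velocity `p′ = v·(T + L·(t̂·q⊥)·t̂)` (with `t̂ = p × T` and `q⊥ = q − (q·p)p`) and the target
`q` moves along its trajectory with `q′ = (p′·T)·R(T)`, then the geodesic distance satisfies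
`d/dt arccos(p·q) = −L·v·(t̂·q⊥)²/‖q⊥‖ ≤ 0`; in particular it is nonincreasing. -/
theorem outer_loop_geodesic_distance_decreasing
    (p q : ℝ → Fin 3 → ℝ) (hp : Differentiable ℝ p) (hq : Differentiable ℝ q)
    (hpu : ∀ t, norm3 (p t) = 1) (hqu : ∀ t, norm3 (q t) = 1)
    (hne : ∀ t, p t ≠ q t) (hne' : ∀ t, p t ≠ -(q t))
    (T : ℝ → Fin 3 → ℝ) (hT : Differentiable ℝ T)
    (hTu : ∀ t, norm3 (T t) = 1) (hTp : ∀ t, dot3 (T t) (p t) = 0)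
    (v : ℝ → ℝ) (hv : ∀ t, 0 ≤ v t) (L : ℝ) (hL : 0 < L)
    (hdp : ∀ t, deriv p t
      = v t • (T t + (L * dot3 (cross3 (p t) (T t)) (q t - dot3 (q t) (p t) • p t))
          • cross3 (p t) (T t)))
    (hdq : ∀ t, deriv q t = dot3 (deriv p t) (T t) • Rgeo (p t) (q t) (T t)) :
    (∀ t, deriv (fun s => Real.arccos (dot3 (p s) (q s))) t
        = -(L * v t * dot3 (cross3 (p t) (T t)) (q t - dot3 (q t) (p t) • p t) ^ 2
            / norm3 (q t - dot3 (q t) (p t) • p t))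
      ∧ deriv (fun s => Real.arccos (dot3 (p s) (q s))) t ≤ 0)
    ∧ Antitone (fun s => Real.arccos (dot3 (p s) (q s))) := by
  have hasDeriv : ∀ t, HasDerivAt (fun s => Real.arccos (dot3 (p s) (q s)))
      (-(L * v t * dot3 (cross3 (p t) (T t)) (q t - dot3 (q t) (p t) • p t) ^ 2
            / norm3 (q t - dot3 (q t) (p t) • p t))) t := by
    intro t
    have hp1 := dot3_self_eq_one (hpu t)
    have hq1 := dot3_self_eq_one (hqu t)
    have hT1 := dot3_self_eq_one (hTu t)
    have hlt := dot3_lt_one hp1 hq1 (hne t)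
    have hgt := neg_one_lt_dot3 hp1 hq1 (hne' t)
    have hs : norm3 (cross3 (p t) (q t)) ≠ 0 := by
      refine (Real.sqrt_pos.mpr ?_).ne'
      rw [dot3_cross3_self, hp1, hq1]
      nlinarith
    have speed : dot3 (deriv p t) (T t) = v t := by
      have expand (a : ℝ) : dot3 (v t • (T t + a • cross3 (p t) (T t))) (T t)
          = v t * dot3 (T t) (T t) := by
        simp [dot3, cross3, Matrix.vecHead, Matrix.vecTail]
        ring
      rw [hdp, expand, hT1, mul_one]
    have kite : dot3 (deriv p t) (q t)
        = v t * (dot3 (T t) (q t) + L * dot3 (cross3 (p t) (T t)) (q t) ^ 2) := by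
      have expand (a : ℝ) : dot3 (v t • (T t + a • cross3 (p t) (T t))) (q t)
          = v t * (dot3 (T t) (q t) + a * dot3 (cross3 (p t) (T t)) (q t)) := by
        simp [dot3]
        ring
      rw [hdp, expand, dot3_cross3_perp]
      ring
    have target : dot3 (p t) (deriv q t) = -(v t * dot3 (T t) (q t)) := by
      have smul_right (a : ℝ) (x y : Fin 3 → ℝ) : dot3 x (a • y) = a * dot3 x y := by
        simp [dot3]
        ring
      rw [hdq, smul_right, speed, dot3_Rgeo hp1 (hTp t) hs]
      ring
    refine ((Real.hasDerivAt_arccos hgt.ne' hlt.ne).comp t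
      ((hp t).hasDerivAt.dot3 (hq t).hasDerivAt)).congr_deriv ?_
    rw [kite, target, norm3_perp hp1 hq1, dot3_cross3_perp]
    ring
  have nonpos : ∀ t, deriv (fun s => Real.arccos (dot3 (p s) (q s))) t ≤ 0 := by
    intro t
    rw [(hasDeriv t).deriv, neg_nonpos]
    exact div_nonneg (mul_nonneg (mul_nonneg hL.le (hv t)) (sq_nonneg _)) (Real.sqrt_nonneg _)
  exact ⟨fun t => ⟨(hasDeriv t).deriv, nonpos t⟩,
    antitone_of_deriv_nonpos (fun t => (hasDeriv t).differentiableAt) nonpos⟩
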